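/- Let $p\in(1,\infty)$, let $w\in A_p$ on $\mathbb{R}^n$, and let $b\in BMO(\mathbb{R}^n)$. There exists a constant $\varepsilon_n'>0$ depending only on $n$ such that for every $z\in\mathbb{C}$ with $|z|\le \varepsilon_n'\min(1,p-1)/\big((w)_{A_p}\,\|b\|_{BMO}\big)$ and every cube $Q\subset\mathbb{R}^n$, one has $\Big(\frac{1}{|Q|}\int_Q e^{\Re(bz)}w\Big)\Big(\frac{1}{|Q|}\int_Q (e^{\Re(bz)}w)^{1-p'}\Big)^{p-1}\le 4^p\,[w]_{A_p}$; in particular $[e^{\Re(bz)}w]_{A_p}\le 4^p[w]_{A_p}$. -/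

import Mathlib

open MeasureTheory ENNReal

noncomputable section

/-- An axis-parallel cube in `ℝⁿ` (with positive side length). -/
def IsCube {n : ℕ} (Q : Set (Fin n → ℝ)) : Prop :=
  ∃ (a : Fin n → ℝ) (h : ℝ), 0 < h ∧ Q = Set.Icc a (a + fun _ => h)

/-- Average of an `ℝ≥0∞`-valued function over a set. -/
def avgL {n : ℕ} (Q : Set (Fin n → ℝ)) (f : (Fin n → ℝ) → ℝ≥0∞) : ℝ≥0∞ :=
  (∫⁻ x in Q, f x) / volume Q

/-- Average of a real-valued function over a set. -/
def avgR {n : ℕ} (Q : Set (Fin n → ℝ)) (f : (Fin n → ℝ) → ℝ) : ℝ :=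
  (∫ x in Q, f x) / (volume Q).toReal

/-- The `A_p` product for a single cube. -/
def apTerm (n : ℕ) (p : ℝ) (w : (Fin n → ℝ) → ℝ) (Q : Set (Fin n → ℝ)) : ℝ≥0∞ :=
  avgL Q (fun x => ENNReal.ofReal (w x)) *
    avgL Q (fun x => ENNReal.ofReal (w x) ^ (1 - p / (p - 1))) ^ (p - 1)

/-- The Muckenhoupt `A_p` constant. -/
def apConst (n : ℕ) (p : ℝ) (w : (Fin n → ℝ) → ℝ) : ℝ≥0∞ :=
  ⨆ (Q : Set (Fin n → ℝ)) (_ : IsCube Q), apTerm n p w Q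

/-- A weight: locally integrable and a.e. positive. -/
def IsWeight (n : ℕ) (w : (Fin n → ℝ) → ℝ) : Prop :=
  LocallyIntegrable w volume ∧ ∀ᵐ x ∂(volume : Measure (Fin n → ℝ)), 0 < w x

/-- BMO norm of a real-valued function. -/
def bmoNorm (n : ℕ) (b : (Fin n → ℝ) → ℝ) : ℝ≥0∞ :=
  ⨆ (Q : Set (Fin n → ℝ)) (_ : IsCube Q),
    (∫⁻ x in Q, (‖b x - avgR Q b‖₊ : ℝ≥0∞)) / volume Q

/-- Weighted BMO norm of a real-valued function. -/
def bmoNormW (n : ℕ) (ν b : (Fin n → ℝ) → ℝ) : ℝ≥0∞ :=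
  ⨆ (Q : Set (Fin n → ℝ)) (_ : IsCube Q),
    (∫⁻ x in Q, (‖b x - avgR Q b‖₊ : ℝ≥0∞)) / (∫⁻ x in Q, ENNReal.ofReal (ν x))

/-- The (uncentered, cube-based) Hardy–Littlewood maximal operator. -/
def hlMax (n : ℕ) (f : (Fin n → ℝ) → ℝ≥0∞) (x : Fin n → ℝ) : ℝ≥0∞ :=
  ⨆ (Q : Set (Fin n → ℝ)) (_ : IsCube Q) (_ : x ∈ Q), avgL Q f

/-- The Fujii–Wilson `A_∞` constant. -/
def fwConst (n : ℕ) (w : (Fin n → ℝ) → ℝ) : ℝ≥0∞ :=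
  ⨆ (Q : Set (Fin n → ℝ)) (_ : IsCube Q),
    (∫⁻ x in Q, hlMax n (Q.indicator fun y => ENNReal.ofReal (w y)) x) /
      (∫⁻ x in Q, ENNReal.ofReal (w x))

/-- `(w)_{A_p} := max([w]_{A_∞}, [σ]_{A_∞})` where `σ = w^{1-p'}` is the dual weight. -/
def apMax (n : ℕ) (p : ℝ) (w : (Fin n → ℝ) → ℝ) : ℝ≥0∞ :=
  max (fwConst n w) (fwConst n (fun x => w x ^ (1 - p / (p - 1))))

/-- The `L^p(w)` (quasi-)norm. -/
def wNorm (n : ℕ) (p : ℝ) (w : (Fin n → ℝ) → ℝ) (f : (Fin n → ℝ) → ℝ) : ℝ≥0∞ :=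
  (∫⁻ x, (‖f x‖₊ : ℝ≥0∞) ^ p * ENNReal.ofReal (w x)) ^ (1 / p)

/-- The operator (quasi-)norm from `L^p(μ)` to `L^p(λ)`. -/
def opNormW (n : ℕ) (p : ℝ) (μ lam : (Fin n → ℝ) → ℝ)
    (S : ((Fin n → ℝ) → ℝ) → ((Fin n → ℝ) → ℝ)) : ℝ≥0∞ :=
  sInf {c : ℝ≥0∞ | ∀ f, wNorm n p lam (S f) ≤ c * wNorm n p μ f}

/-- The commutator `[b, S] = M_b ∘ S - S ∘ M_b`. -/
def commOp (n : ℕ) (b : (Fin n → ℝ) → ℝ)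
    (S : ((Fin n → ℝ) → ℝ) → ((Fin n → ℝ) → ℝ)) :
    ((Fin n → ℝ) → ℝ) → ((Fin n → ℝ) → ℝ) :=
  fun f x => b x * S f x - S (fun y => b y * f y) x


/-- Average of a complex-valued function over a set. -/
def avgC {n : ℕ} (Q : Set (Fin n → ℝ)) (f : (Fin n → ℝ) → ℂ) : ℂ :=
  (∫ x in Q, f x) / ((volume Q).toReal : ℂ)

/-- BMO norm of a complex-valued function. -/
def bmoNormC (n : ℕ) (b : (Fin n → ℝ) → ℂ) : ℝ≥0∞ :=
  ⨆ (Q : Set (Fin n → ℝ)) (_ : IsCube Q),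
    (∫⁻ x in Q, (‖b x - avgC Q b‖₊ : ℝ≥0∞)) / volume Q

section AbstractTree

variable {X : Type*} [MeasurableSpace X] {ι : Type*}

/-- The set covered by the `k`-th generation of stopping cubes below a given cube. -/
def treeSet (D : ι → Set X) (ch : ι → Set ι) : ℕ → ι → Set X
  | 0, S => D S
  | k + 1, S => ⋃ P ∈ ch S, treeSet D ch k P

/-- Structural properties of a stopping tree. -/
structure GoodTree (D : ι → Set X) (ch : ι → Set ι) : Prop where
  meas : ∀ c, MeasurableSet (D c)
  sub : ∀ S, ∀ P ∈ ch S, D P ⊆ D S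
  disj : ∀ S, (ch S).PairwiseDisjoint D

variable {D : ι → Set X} {ch : ι → Set ι}

theorem treeSet_sub (T : GoodTree D ch) (k : ℕ) : ∀ S, treeSet D ch k S ⊆ D S := by
  induction k with
  | zero => intro S; exact subset_rfl
  | succ k ih =>
    intro S
    simp only [treeSet]
    exact Set.iUnion₂_subset fun P hP => (ih P).trans (T.sub S P hP)

theorem treeSet_meas [Countable ι] (T : GoodTree D ch) (k : ℕ) :
    ∀ S, MeasurableSet (treeSet D ch k S) := by
  induction k with
  | zero => intro S; exact T.meas S
  | succ k ih =>
    intro S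
    simp only [treeSet]
    exact MeasurableSet.biUnion (Set.to_countable _) fun P _ => ih P

theorem treeSet_anti_succ (T : GoodTree D ch) (k : ℕ) :
    ∀ S, treeSet D ch (k + 1) S ⊆ treeSet D ch k S := by
  induction k with
  | zero => intro S; exact treeSet_sub T 1 S
  | succ k ih =>
    intro S
    rw [treeSet, treeSet]
    exact Set.iUnion₂_mono fun P _ => ih P

theorem treeSet_anti (T : GoodTree D ch) (S : ι) : Antitone fun k => treeSet D ch k S :=
  antitone_nat_of_succ_le fun k => treeSet_anti_succ T k S

theorem treeSet_disj (T : GoodTree D ch) (k : ℕ) (S : ι) :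
    (ch S).PairwiseDisjoint (treeSet D ch k) := fun P hP P' hP' hne =>
  (T.disj S hP hP' hne).mono (treeSet_sub T k P) (treeSet_sub T k P')

theorem treeSet_lintegral_succ [Countable ι] (T : GoodTree D ch) {μ : Measure X} (v : X → ℝ≥0∞)
    (k : ℕ) (S : ι) :
    ∫⁻ x in treeSet D ch (k + 1) S, v x ∂μ
      = ∑' P : ch S, ∫⁻ x in treeSet D ch k P, v x ∂μ := by
  rw [treeSet, lintegral_biUnion (Set.to_countable _) (fun P _ => treeSet_meas T k P)
    (treeSet_disj T k S)]

theorem treeSet_decay [Countable ι] (T : GoodTree D ch) {μ : Measure X} (v : X → ℝ≥0∞) (m : ℕ)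
    (k : ℕ) : ∀ S, (∀ c, D c ⊆ D S → 4 * ∫⁻ x in treeSet D ch m c, v x ∂μ ≤ ∫⁻ x in D c, v x ∂μ) →
      4 * ∫⁻ x in treeSet D ch (k + m) S, v x ∂μ ≤ ∫⁻ x in treeSet D ch k S, v x ∂μ := by
  induction k with
  | zero => intro S h; simpa [treeSet] using h S subset_rfl
  | succ k ih =>
    intro S h
    rw [show k + 1 + m = (k + m) + 1 by ring, treeSet_lintegral_succ T, treeSet_lintegral_succ T,
      ← ENNReal.tsum_mul_left]
    exact ENNReal.tsum_le_tsum fun P => ih P fun c hc => h c (hc.trans (T.sub S P P.2))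

/-- One generation estimate. -/
theorem treeSet_gen [Countable ι] (T : GoodTree D ch) {μ : Measure X} (v : X → ℝ≥0∞)
    (hhalf : ∀ S, μ (D S) ≤ 2 * μ (D S \ treeSet D ch 1 S))
    (hpos : ∀ S, μ (D S) ≠ 0) (hfin : ∀ S, μ (D S) ≠ ⊤)
    (g : X → ℝ≥0∞) (k : ℕ) : ∀ S,
      (∀ c, D c ⊆ D S → ∀ x ∈ D c, (∫⁻ y in D c, v y ∂μ) / μ (D c) ≤ g x) →
      ∫⁻ x in treeSet D ch k S, v x ∂μ
        ≤ 2 * ∫⁻ x in treeSet D ch k S \ treeSet D ch (k + 1) S, g x ∂μ := by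
  induction k with
  | zero =>
    intro S h
    have h1 : ∫⁻ x in D S \ treeSet D ch 1 S, (∫⁻ y in D S, v y ∂μ) / μ (D S) ∂μ
        ≤ ∫⁻ x in D S \ treeSet D ch 1 S, g x ∂μ :=
      setLIntegral_mono' ((T.meas S).diff (treeSet_meas T 1 S)) fun x hx =>
        h S subset_rfl x hx.1
    rw [setLIntegral_const] at h1
    calc ∫⁻ x in D S, v x ∂μ = ((∫⁻ y in D S, v y ∂μ) / μ (D S)) * μ (D S) :=
          (ENNReal.div_mul_cancel (hpos S) (hfin S)).symm
      _ ≤ ((∫⁻ y in D S, v y ∂μ) / μ (D S)) * (2 * μ (D S \ treeSet D ch 1 S)) := by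
          gcongr; exact hhalf S
      _ = 2 * (((∫⁻ y in D S, v y ∂μ) / μ (D S)) * μ (D S \ treeSet D ch 1 S)) := by ring
      _ ≤ _ := by gcongr; exact h1
  | succ k ih =>
    intro S h
    have hset : treeSet D ch (k + 1) S \ treeSet D ch (k + 1 + 1) S
        = ⋃ P ∈ ch S, (treeSet D ch k P \ treeSet D ch (k + 1) P) := by
      ext x
      simp only [Set.mem_sdiff]
      rw [treeSet, treeSet]
      simp only [Set.mem_iUnion, Set.mem_sdiff, exists_prop, not_exists, not_and]
      constructor
      · rintro ⟨⟨P, hP, hx⟩, hn⟩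
        exact ⟨P, hP, hx, hn P hP⟩
      · rintro ⟨P, hP, hx, hn⟩
        refine ⟨⟨P, hP, hx⟩, fun P' hP' hx' => ?_⟩
        by_cases hPP : P = P'
        · subst hPP; exact hn hx'
        · exact Set.disjoint_left.1 (T.disj S hP hP' hPP) (treeSet_sub T _ _ hx)
            (treeSet_sub T _ _ hx')
    rw [treeSet_lintegral_succ T, hset, lintegral_biUnion (Set.to_countable _)
      (fun P _ => (treeSet_meas T k P).diff (treeSet_meas T (k + 1) P))
      ((treeSet_disj T k S).mono fun P => Set.sdiff_subset), ← ENNReal.tsum_mul_left]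
    exact ENNReal.tsum_le_tsum fun P => ih P fun c hc => h c (hc.trans (T.sub S P P.2))

theorem treeSet_sum [Countable ι] (T : GoodTree D ch) {μ : Measure X} (v : X → ℝ≥0∞)
    (hhalf : ∀ S, μ (D S) ≤ 2 * μ (D S \ treeSet D ch 1 S))
    (hpos : ∀ S, μ (D S) ≠ 0) (hfin : ∀ S, μ (D S) ≠ ⊤)
    (g : X → ℝ≥0∞) (S : ι)
    (h : ∀ c, D c ⊆ D S → ∀ x ∈ D c, (∫⁻ y in D c, v y ∂μ) / μ (D c) ≤ g x) (m : ℕ) :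
      ∑ k ∈ Finset.range m, ∫⁻ x in treeSet D ch k S, v x ∂μ
        ≤ 2 * ∫⁻ x in D S \ treeSet D ch m S, g x ∂μ := by
  induction m with
  | zero => simp
  | succ m ih =>
    rw [Finset.sum_range_succ]
    refine (add_le_add ih (treeSet_gen T v hhalf hpos hfin g m S h)).trans ?_
    rw [← mul_add, ← lintegral_union ((treeSet_meas T m S).diff (treeSet_meas T (m + 1) S))]
    · gcongr
      rintro x (hx | hx)
      · exact ⟨hx.1, fun h => hx.2 (treeSet_anti_succ T m S h)⟩
      · exact ⟨treeSet_sub T m S hx.1, hx.2⟩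
    · exact Set.disjoint_left.2 fun x hx hx' => hx.2 hx'.1

theorem treeSet_quarter [Countable ι] (T : GoodTree D ch) {μ : Measure X} (v : X → ℝ≥0∞)
    (hhalf : ∀ S, μ (D S) ≤ 2 * μ (D S \ treeSet D ch 1 S))
    (hpos : ∀ S, μ (D S) ≠ 0) (hfin : ∀ S, μ (D S) ≠ ⊤)
    (g : X → ℝ≥0∞) (S : ι)
    (h : ∀ c, D c ⊆ D S → ∀ x ∈ D c, (∫⁻ y in D c, v y ∂μ) / μ (D c) ≤ g x)
    (A : ℝ≥0∞) (hA0 : A ≠ 0) (hA : A ≠ ⊤) (hg : ∫⁻ x in D S, g x ∂μ ≤ A * ∫⁻ x in D S, v x ∂μ)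
    (m : ℕ) (hm : 8 * A ≤ (m : ℝ≥0∞)) :
      4 * ∫⁻ x in treeSet D ch m S, v x ∂μ ≤ ∫⁻ x in D S, v x ∂μ := by
  have h1 := treeSet_sum T v hhalf hpos hfin g S h m
  have h2 : (m : ℝ≥0∞) * ∫⁻ x in treeSet D ch m S, v x ∂μ
      ≤ ∑ k ∈ Finset.range m, ∫⁻ x in treeSet D ch k S, v x ∂μ := by
    rw [← nsmul_eq_mul]
    have := Finset.card_nsmul_le_sum (Finset.range m)
      (fun k => ∫⁻ x in treeSet D ch k S, v x ∂μ) (∫⁻ x in treeSet D ch m S, v x ∂μ)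
      (fun k hk => lintegral_mono_set (treeSet_anti T S (Finset.mem_range.1 hk).le))
    simpa using this
  have h3 : 2 * ∫⁻ x in D S \ treeSet D ch m S, g x ∂μ ≤ 2 * (A * ∫⁻ x in D S, v x ∂μ) := by
    gcongr
    exact (lintegral_mono_set Set.sdiff_subset).trans hg
  have h4 : (2 * A) * (4 * ∫⁻ x in treeSet D ch m S, v x ∂μ)
      ≤ (2 * A) * ∫⁻ x in D S, v x ∂μ := by
    calc (2 * A) * (4 * ∫⁻ x in treeSet D ch m S, v x ∂μ)
        = 8 * A * ∫⁻ x in treeSet D ch m S, v x ∂μ := by ring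
      _ ≤ m * ∫⁻ x in treeSet D ch m S, v x ∂μ := by gcongr
      _ ≤ 2 * (A * ∫⁻ x in D S, v x ∂μ) := h2.trans (h1.trans h3)
      _ = _ := by ring
  exact (ENNReal.mul_le_mul_iff_right (by simp [hA0]) (by finiteness)).1 h4

theorem treeSet_ptwise (f : ι → X → ℝ) (C : ℝ) (hC : 0 ≤ C)
    (hpar : ∀ S, ∀ P ∈ ch S, ∀ x, f S x ≤ f P x + C)
    (x : X) (hx : ∀ S, x ∈ D S → x ∉ treeSet D ch 1 S → f S x ≤ C) (k : ℕ) :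
    ∀ S, x ∈ D S → x ∉ treeSet D ch k S → f S x ≤ C * k := by
  induction k with
  | zero => intro S h h'; exact absurd h h'
  | succ k ih =>
    intro S h h'
    by_cases h1 : x ∈ treeSet D ch 1 S
    · simp only [treeSet, Set.mem_iUnion] at h1 h'
      obtain ⟨P, hP, hxP⟩ := h1
      have := ih P hxP fun hh => h' ⟨P, hP, hh⟩
      have := hpar S P hP x
      push_cast; linarith
    · have h2 := hx S h h1
      have : 0 ≤ C * k := by positivity
      push_cast; linarith

theorem treeSet_exp [Countable ι] (T : GoodTree D ch) {μ : Measure X} (v : X → ℝ≥0∞)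
    (hv : AEMeasurable v μ) (S : ι) (hfin : ∫⁻ x in D S, v x ∂μ ≠ ⊤) (m : ℕ)
    (hq : ∀ c, D c ⊆ D S → 4 * ∫⁻ x in treeSet D ch m c, v x ∂μ ≤ ∫⁻ x in D c, v x ∂μ)
    (f : ι → X → ℝ) (C : ℝ) (hC : 0 ≤ C)
    (hpar : ∀ S, ∀ P ∈ ch S, ∀ x, f S x ≤ f P x + C)
    (hae : ∀ᵐ x ∂μ, ∀ S, x ∈ D S → x ∉ treeSet D ch 1 S → f S x ≤ C)
    (s : ℝ) (hs : 0 ≤ s) (hsm : Real.exp (s * C * m) ≤ 2) :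
    ∫⁻ x in D S, ENNReal.ofReal (Real.exp (s * f S x)) * v x ∂μ ≤ 4 * ∫⁻ x in D S, v x ∂μ := by
  have hdec : ∀ k : ℕ, ∫⁻ x in treeSet D ch (k * m) S, v x ∂μ
      ≤ (4⁻¹ : ℝ≥0∞) ^ k * ∫⁻ x in D S, v x ∂μ := by
    intro k
    induction k with
    | zero => simp [treeSet]
    | succ k ih =>
      have := treeSet_decay T v m (k * m) S hq
      rw [show (k + 1) * m = k * m + m by ring, pow_succ', mul_assoc]
      rw [← ENNReal.div_eq_inv_mul, ENNReal.le_div_iff_mul_le (by simp) (by simp), mul_comm]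
      exact this.trans ih
  set N : Set X := ⋂ k : ℕ, treeSet D ch (k * m) S with hN
  have hNm : MeasurableSet N := MeasurableSet.iInter fun k => treeSet_meas T _ S
  have hN0 : ∫⁻ x in N, v x ∂μ = 0 := by
    have hlim : Filter.Tendsto (fun k : ℕ => (4⁻¹ : ℝ≥0∞) ^ k * ∫⁻ x in D S, v x ∂μ)
        Filter.atTop (nhds (0 * ∫⁻ x in D S, v x ∂μ)) :=
      ENNReal.Tendsto.mul_const (ENNReal.tendsto_pow_atTop_nhds_zero_of_lt_one (by
        simp [ENNReal.inv_lt_one])) (Or.inr hfin)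
    rw [zero_mul] at hlim
    exact le_antisymm (ge_of_tendsto' hlim fun k =>
      (lintegral_mono_set (Set.iInter_subset _ k)).trans (hdec k)) (by simp)
  have hN1 : ∫⁻ x in N, ENNReal.ofReal (Real.exp (s * f S x)) * v x ∂μ = 0 := by
    rw [lintegral_eq_zero_iff' hv.restrict] at hN0
    rw [← lintegral_zero (μ := μ.restrict N)]
    apply lintegral_congr_ae
    filter_upwards [hN0] with x hx
    simp [hx]
  have hcover : D S ⊆ N ∪ ⋃ k : ℕ, (treeSet D ch (k * m) S \ treeSet D ch ((k + 1) * m) S) := by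
    intro x hx
    by_cases hxN : x ∈ N
    · exact Or.inl hxN
    · right
      simp only [hN, Set.mem_iInter, not_forall] at hxN
      classical
      have hsp := Nat.find_spec hxN
      have hmin := fun j (hj : j < Nat.find hxN) => not_not.1 (Nat.find_min hxN hj)
      have hne : Nat.find hxN ≠ 0 := by
        intro h0
        rw [h0] at hsp
        exact hsp (by simpa [treeSet] using hx)
      obtain ⟨k, hk⟩ := Nat.exists_eq_succ_of_ne_zero hne
      rw [hk] at hsp hmin
      exact Set.mem_iUnion.2 ⟨k, hmin k (Nat.lt_succ_self k), hsp⟩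
  have hpiece : ∀ k : ℕ, ∫⁻ x in treeSet D ch (k * m) S \ treeSet D ch ((k + 1) * m) S,
      ENNReal.ofReal (Real.exp (s * f S x)) * v x ∂μ
        ≤ 2 * (2⁻¹ : ℝ≥0∞) ^ k * ∫⁻ x in D S, v x ∂μ := by
    intro k
    have h1 : ∫⁻ x in treeSet D ch (k * m) S \ treeSet D ch ((k + 1) * m) S,
        ENNReal.ofReal (Real.exp (s * f S x)) * v x ∂μ
        ≤ ∫⁻ x in treeSet D ch (k * m) S \ treeSet D ch ((k + 1) * m) S,
        2 ^ (k + 1) * v x ∂μ := by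
      refine setLIntegral_mono_ae' ((treeSet_meas T _ S).diff (treeSet_meas T _ S)) ?_
      filter_upwards [hae] with x hx hxm
      gcongr
      have hb := treeSet_ptwise (D := D) f C hC hpar x hx ((k + 1) * m) S
        (treeSet_sub T _ _ hxm.1) hxm.2
      have : Real.exp (s * f S x) ≤ 2 ^ (k + 1) := by
        calc Real.exp (s * f S x) ≤ Real.exp (s * (C * (((k + 1) * m : ℕ) : ℝ))) := by gcongr
          _ = Real.exp (s * C * m) ^ (k + 1) := by
            rw [← Real.exp_nat_mul]; congr 1; push_cast; ring
          _ ≤ _ := by gcongr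
      calc ENNReal.ofReal (Real.exp (s * f S x)) ≤ ENNReal.ofReal (2 ^ (k + 1)) :=
            ENNReal.ofReal_le_ofReal this
        _ = _ := by rw [ENNReal.ofReal_pow (by norm_num)]; simp
    refine h1.trans ?_
    rw [lintegral_const_mul' _ _ (by finiteness)]
    calc 2 ^ (k + 1) * ∫⁻ x in treeSet D ch (k * m) S \ treeSet D ch ((k + 1) * m) S, v x ∂μ
        ≤ 2 ^ (k + 1) * ((4⁻¹ : ℝ≥0∞) ^ k * ∫⁻ x in D S, v x ∂μ) := by
          gcongr
          exact (lintegral_mono_set Set.sdiff_subset).trans (hdec k)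
      _ = 2 * (2 * 4⁻¹) ^ k * ∫⁻ x in D S, v x ∂μ := by rw [mul_pow, pow_succ]; ring
      _ = _ := by
          congr 3
          rw [show (4 : ℝ≥0∞) = 2 * 2 by norm_num, ENNReal.mul_inv (by simp) (by simp),
            ← mul_assoc, ENNReal.mul_inv_cancel (by simp) (by simp), one_mul]
  calc ∫⁻ x in D S, ENNReal.ofReal (Real.exp (s * f S x)) * v x ∂μ
      ≤ ∫⁻ x in N ∪ ⋃ k : ℕ, (treeSet D ch (k * m) S \ treeSet D ch ((k + 1) * m) S),
        ENNReal.ofReal (Real.exp (s * f S x)) * v x ∂μ := lintegral_mono_set hcover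
    _ ≤ _ := lintegral_union_le _ _ _
    _ ≤ 0 + ∑' k : ℕ, 2 * (2⁻¹ : ℝ≥0∞) ^ k * ∫⁻ x in D S, v x ∂μ := by
        gcongr
        · exact hN1.le
        · exact (lintegral_iUnion_le _ _).trans (ENNReal.tsum_le_tsum hpiece)
    _ = 4 * ∫⁻ x in D S, v x ∂μ := by
        rw [zero_add, ENNReal.tsum_mul_right, ENNReal.tsum_mul_left, ENNReal.tsum_geometric,
          ENNReal.one_sub_inv_two, inv_inv]
        norm_num

end AbstractTree

section Dyadic

variable {n : ℕ}

/-- Index of the dyadic cube of generation `k` containing `x`. -/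
def dIdx (a : Fin n → ℝ) (h : ℝ) (k : ℕ) (x : Fin n → ℝ) : Fin n → ℤ :=
  fun j => ⌊(x j - a j) / (h / 2 ^ k)⌋

/-- Half-open dyadic cube. -/
def dCube (a : Fin n → ℝ) (h : ℝ) (c : ℕ × (Fin n → ℤ)) : Set (Fin n → ℝ) :=
  {x | dIdx a h c.1 x = c.2}

/-- Lower corner of a dyadic cube. -/
def dLo (a : Fin n → ℝ) (h : ℝ) (c : ℕ × (Fin n → ℤ)) : Fin n → ℝ :=
  fun j => a j + h / 2 ^ c.1 * c.2 j

/-- Closed dyadic cube. -/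
def dBox (a : Fin n → ℝ) (h : ℝ) (c : ℕ × (Fin n → ℤ)) : Set (Fin n → ℝ) :=
  Set.Icc (dLo a h c) (dLo a h c + fun _ => h / 2 ^ c.1)

variable {a : Fin n → ℝ} {h : ℝ}

theorem dBox_isCube (hh : 0 < h) (c) : IsCube (dBox a h c) :=
  ⟨dLo a h c, h / 2 ^ c.1, by positivity, rfl⟩

theorem dBox_root : dBox a h (0, 0) = Set.Icc a (a + fun _ => h) := by
  have : dLo a h (0, 0) = a := by ext j; simp [dLo]
  simp [dBox, this]

theorem dCube_eq_pi (hh : 0 < h) (c : ℕ × (Fin n → ℤ)) :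
    dCube a h c = Set.pi Set.univ fun j => Set.Ico (dLo a h c j)
      ((dLo a h c + fun _ => h / 2 ^ c.1 : Fin n → ℝ) j) := by
  ext x
  have hs : 0 < h / 2 ^ c.1 := by positivity
  simp only [dCube, dIdx, Set.mem_setOf_eq, funext_iff, Set.mem_pi, Set.mem_univ, true_imp_iff,
    Set.mem_Ico, Int.floor_eq_iff, dLo, Pi.add_apply]
  refine forall_congr' fun j => ?_
  rw [le_div_iff₀ hs, div_lt_iff₀ hs]
  constructor
  · rintro ⟨h1, h2⟩; constructor <;> linarith
  · rintro ⟨h1, h2⟩; constructor <;> linarith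

theorem dCube_meas (hh : 0 < h) (c : ℕ × (Fin n → ℤ)) : MeasurableSet (dCube a h c) := by
  rw [dCube_eq_pi hh]
  exact MeasurableSet.univ_pi fun j => measurableSet_Ico

theorem dCube_ae (hh : 0 < h) (c : ℕ × (Fin n → ℤ)) :
    dCube a h c =ᵐ[volume] dBox a h c := by
  rw [dCube_eq_pi hh, dBox]
  exact Measure.univ_pi_Ico_ae_eq_Icc

theorem dCube_sub_dBox (hh : 0 < h) (c : ℕ × (Fin n → ℤ)) : dCube a h c ⊆ dBox a h c := by
  rw [dCube_eq_pi hh, dBox]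
  intro x hx
  exact ⟨fun j => (hx j trivial).1, fun j => (hx j trivial).2.le⟩

theorem dBox_vol (c : ℕ × (Fin n → ℤ)) :
    volume (dBox a h c) = ENNReal.ofReal (h / 2 ^ c.1) ^ n := by
  rw [dBox, Real.volume_Icc_pi]
  simp

theorem dCube_vol (hh : 0 < h) (c : ℕ × (Fin n → ℤ)) :
    volume (dCube a h c) = ENNReal.ofReal (h / 2 ^ c.1) ^ n := by
  rw [measure_congr (dCube_ae hh c), dBox_vol]

theorem dCube_vol_ne_zero (hh : 0 < h) (c : ℕ × (Fin n → ℤ)) : volume (dCube a h c) ≠ 0 := by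
  rw [dCube_vol hh]
  have : 0 < h / 2 ^ c.1 := by positivity
  exact pow_ne_zero _ (by simpa using this)

theorem dCube_vol_ne_top (hh : 0 < h) (c : ℕ × (Fin n → ℤ)) : volume (dCube a h c) ≠ ⊤ := by
  rw [dCube_vol hh]
  finiteness

theorem dIdx_nest {k l : ℕ} (hkl : k ≤ l) (x : Fin n → ℝ) (j : Fin n) :
    dIdx a h k x j = dIdx a h l x j / ((2 ^ (l - k) : ℕ) : ℤ) := by
  rw [dIdx, dIdx, ← Int.floor_div_natCast]
  congr 1
  obtain ⟨d, rfl⟩ := Nat.exists_eq_add_of_le hkl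
  simp only [Nat.add_sub_cancel_left, pow_add]
  push_cast
  field_simp

theorem dIdx_eq_of_le {k l : ℕ} (hkl : k ≤ l) {x y : Fin n → ℝ}
    (hxy : dIdx a h l x = dIdx a h l y) : dIdx a h k x = dIdx a h k y := by
  ext j
  rw [dIdx_nest hkl, dIdx_nest hkl, hxy]

theorem dCube_nest {c c' : ℕ × (Fin n → ℤ)} (hle : c.1 ≤ c'.1) {x : Fin n → ℝ}
    (hx : x ∈ dCube a h c) (hx' : x ∈ dCube a h c') : dCube a h c' ⊆ dCube a h c := by
  intro y hy
  exact (dIdx_eq_of_le hle (Eq.trans hy (Eq.symm hx'))).trans hx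

theorem dCube_self (k : ℕ) (x : Fin n → ℝ) : x ∈ dCube a h (k, dIdx a h k x) := rfl

theorem dCube_eq_idx {c : ℕ × (Fin n → ℤ)} {x : Fin n → ℝ} (hx : x ∈ dCube a h c) :
    c = (c.1, dIdx a h c.1 x) := Prod.ext rfl (Eq.symm hx)

theorem dCube_nonempty (hh : 0 < h) (c : ℕ × (Fin n → ℤ)) : (dCube a h c).Nonempty :=
  nonempty_of_measure_ne_zero (dCube_vol_ne_zero hh c)

/-- A cube where the oscillation around the average over `S` is large. -/
def dBad (a : Fin n → ℝ) (h : ℝ) (b : (Fin n → ℝ) → ℂ) (β : ℝ≥0∞) (S P : ℕ × (Fin n → ℤ)) :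
    Prop :=
  2 * β * volume (dCube a h P) < ∫⁻ x in dCube a h P, ‖b x - avgC (dBox a h S) b‖ₑ

/-- Stopping children. -/
def dCh (a : Fin n → ℝ) (h : ℝ) (b : (Fin n → ℝ) → ℂ) (β : ℝ≥0∞) (S : ℕ × (Fin n → ℤ)) :
    Set (ℕ × (Fin n → ℤ)) :=
  {P | S.1 < P.1 ∧ dCube a h P ⊆ dCube a h S ∧ dBad a h b β S P ∧
    ∀ P' : ℕ × (Fin n → ℤ), S.1 < P'.1 → P'.1 < P.1 → dCube a h P ⊆ dCube a h P' →
      ¬ dBad a h b β S P'}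

variable {b : (Fin n → ℝ) → ℂ} {β : ℝ≥0∞}

theorem dCh_disj (S : ℕ × (Fin n → ℤ)) :
    (dCh a h b β S).PairwiseDisjoint (dCube a h) := by
  intro P hP P' hP' hne
  refine Set.disjoint_left.2 fun x hx hx' => ?_
  rcases lt_trichotomy P.1 P'.1 with hlt | heq | hlt
  · exact hP'.2.2.2 P hP.1 hlt (dCube_nest hlt.le hx hx') hP.2.2.1
  · apply hne
    rw [dCube_eq_idx hx, dCube_eq_idx hx', heq]
  · exact hP.2.2.2 P' hP'.1 hlt (dCube_nest hlt.le hx' hx) hP'.2.2.1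

theorem dTree (hh : 0 < h) : GoodTree (dCube a h) (dCh a h b β) where
  meas := dCube_meas hh
  sub := fun _ _ hP => hP.2.1
  disj := dCh_disj

theorem dOsc (hh : 0 < h) (hβ : bmoNormC n b ≤ β) (S : ℕ × (Fin n → ℤ)) :
    ∫⁻ x in dCube a h S, ‖b x - avgC (dBox a h S) b‖ₑ ≤ β * volume (dCube a h S) := by
  rw [setLIntegral_congr (dCube_ae hh S), measure_congr (dCube_ae hh S)]
  have h1 : (∫⁻ x in dBox a h S, (‖b x - avgC (dBox a h S) b‖₊ : ℝ≥0∞)) / volume (dBox a h S)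
      ≤ β := le_trans (le_iSup₂_of_le (dBox a h S) (dBox_isCube hh S) le_rfl) hβ
  have h0 := dCube_vol_ne_zero (a := a) hh S
  have ht := dCube_vol_ne_top (a := a) hh S
  rw [measure_congr (dCube_ae hh S)] at h0 ht
  exact (ENNReal.div_le_iff h0 ht).1 h1

theorem treeSet_one (D : (ℕ × (Fin n → ℤ)) → Set (Fin n → ℝ)) (ch) (S) :
    treeSet D ch 1 S = ⋃ P ∈ ch S, D P := rfl

theorem dHalf (hh : 0 < h) (hβ : bmoNormC n b ≤ β) (hβ0 : β ≠ 0) (hβt : β ≠ ⊤)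
    (S : ℕ × (Fin n → ℤ)) :
    volume (dCube a h S)
      ≤ 2 * volume (dCube a h S \ treeSet (dCube a h) (dCh a h b β) 1 S) := by
  have T : GoodTree (dCube a h) (dCh a h b β) := dTree hh
  have hsub := treeSet_sub T 1 S
  have hΩ : 2 * volume (treeSet (dCube a h) (dCh a h b β) 1 S) ≤ volume (dCube a h S) := by
    have h1 : β * (2 * volume (treeSet (dCube a h) (dCh a h b β) 1 S))
        ≤ β * volume (dCube a h S) := by
      calc β * (2 * volume (treeSet (dCube a h) (dCh a h b β) 1 S))
          = ∑' P : dCh a h b β S, 2 * β * volume (dCube a h P) := by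
            rw [treeSet_one, measure_biUnion (Set.to_countable _) (dCh_disj S)
              (fun P _ => dCube_meas hh P), ENNReal.tsum_mul_left]
            ring
        _ ≤ ∑' P : dCh a h b β S, ∫⁻ x in dCube a h P, ‖b x - avgC (dBox a h S) b‖ₑ :=
            ENNReal.tsum_le_tsum fun P => P.2.2.2.1.le
        _ = ∫⁻ x in treeSet (dCube a h) (dCh a h b β) 1 S, ‖b x - avgC (dBox a h S) b‖ₑ := by
            rw [treeSet_one, lintegral_biUnion (Set.to_countable _)
              (fun P _ => dCube_meas hh P) (dCh_disj S)]
        _ ≤ ∫⁻ x in dCube a h S, ‖b x - avgC (dBox a h S) b‖ₑ := lintegral_mono_set hsub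
        _ ≤ _ := dOsc hh hβ S
    exact (ENNReal.mul_le_mul_iff_right hβ0 hβt).1 h1
  have hadd := measure_diff_add_inter (μ := volume) (dCube a h S) (treeSet_meas T 1 S)
  rw [Set.inter_eq_self_of_subset_right hsub] at hadd
  have h2 : volume (dCube a h S) + volume (dCube a h S) ≤
      2 * volume (dCube a h S \ treeSet (dCube a h) (dCh a h b β) 1 S) + volume (dCube a h S) := by
    calc volume (dCube a h S) + volume (dCube a h S) = 2 * volume (dCube a h S) := by ring
      _ = 2 * volume (dCube a h S \ treeSet (dCube a h) (dCh a h b β) 1 S)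
          + 2 * volume (treeSet (dCube a h) (dCh a h b β) 1 S) := by rw [← mul_add, hadd]
      _ ≤ _ := by gcongr
  exact (ENNReal.add_le_add_iff_right (dCube_vol_ne_top hh S)).1 h2

theorem locInt_dBox (hb : LocallyIntegrable b volume) (c : ℕ × (Fin n → ℤ)) :
    IntegrableOn b (dBox a h c) volume := hb.integrableOn_isCompact isCompact_Icc

theorem dAvg_sub (hh : 0 < h) (hb : LocallyIntegrable b volume) (P : ℕ × (Fin n → ℤ)) (z : ℂ) :
    ‖avgC (dBox a h P) b - z‖ₑ * volume (dCube a h P) ≤ ∫⁻ x in dCube a h P, ‖b x - z‖ₑ := by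
  rw [setLIntegral_congr (dCube_ae hh P), measure_congr (dCube_ae hh P)]
  have h0 := dCube_vol_ne_zero (a := a) hh P
  have ht := dCube_vol_ne_top (a := a) hh P
  rw [measure_congr (dCube_ae hh P)] at h0 ht
  have hr : ((volume (dBox a h P)).toReal : ℂ) ≠ 0 := by
    exact_mod_cast (ENNReal.toReal_pos h0 ht).ne'
  have h1 : ∫ x in dBox a h P, (b x - z)
      = (avgC (dBox a h P) b - z) * ((volume (dBox a h P)).toReal : ℂ) := by
    rw [integral_sub (locInt_dBox hb P) (by
      have : IsFiniteMeasure (volume.restrict (dBox a h P)) := ⟨by simpa using ht.lt_top⟩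
      exact integrable_const _), sub_mul, avgC, div_mul_cancel₀ _ hr]
    simp [measureReal_def, mul_comm]
  have h2 := enorm_integral_le_lintegral_enorm (μ := volume.restrict (dBox a h P))
    (fun x => b x - z)
  rw [h1, enorm_mul] at h2
  have h3 : ‖((volume (dBox a h P)).toReal : ℂ)‖ₑ = volume (dBox a h P) := by
    rw [← ofReal_norm, Complex.norm_real, Real.norm_of_nonneg ENNReal.toReal_nonneg,
      ENNReal.ofReal_toReal ht]
  rwa [h3] at h2

theorem dParent (hh : 0 < h) (hb : LocallyIntegrable b volume) (hβ : bmoNormC n b ≤ β)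
    (hβt : β ≠ ⊤) (S : ℕ × (Fin n → ℤ)) (P : ℕ × (Fin n → ℤ)) (hP : P ∈ dCh a h b β S) :
    ‖avgC (dBox a h P) b - avgC (dBox a h S) b‖ ≤ 2 * 2 ^ n * β.toReal := by
  obtain ⟨x, hx⟩ := dCube_nonempty (a := a) hh P
  have hxS := hP.2.1 hx
  obtain ⟨l, hl⟩ : ∃ l, P.1 = l + 1 := Nat.exists_eq_succ_of_ne_zero (by have := hP.1; omega)
  have hSl : S.1 ≤ l := by have := hP.1; omega
  set R : ℕ × (Fin n → ℤ) := (l, dIdx a h l x) with hR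
  have hPR : dCube a h P ⊆ dCube a h R := dCube_nest (by simp [hR, hl]) (dCube_self l x) hx
  have hR2 : ∫⁻ x in dCube a h R, ‖b x - avgC (dBox a h S) b‖ₑ ≤ 2 * β * volume (dCube a h R) := by
    rcases hSl.eq_or_lt with he | hlt
    · have : S = R := by rw [dCube_eq_idx hxS, hR, he]
      rw [← this]
      refine (dOsc hh hβ S).trans ?_
      gcongr
      rw [two_mul]; exact le_self_add
    · exact not_lt.1 (hP.2.2.2 R hlt (by simp [hR, hl]) hPR)
  have hvol : volume (dCube a h R) = 2 ^ n * volume (dCube a h P) := by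
    rw [dCube_vol hh, dCube_vol hh, ← mul_pow, hl]
    congr 1
    rw [show (2 : ℝ≥0∞) = ENNReal.ofReal 2 by simp, ← ENNReal.ofReal_mul (by norm_num)]
    congr 1
    simp only [hR, pow_succ]
    field_simp
  have h1 : ‖avgC (dBox a h P) b - avgC (dBox a h S) b‖ₑ * volume (dCube a h P)
      ≤ (2 * 2 ^ n * β) * volume (dCube a h P) := by
    calc _ ≤ _ := dAvg_sub hh hb P _
      _ ≤ _ := lintegral_mono_set hPR
      _ ≤ _ := hR2
      _ = _ := by rw [hvol]; ring
  have h2 := (ENNReal.mul_le_mul_iff_left (dCube_vol_ne_zero hh P) (dCube_vol_ne_top hh P)).1 h1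
  have h3 := ENNReal.toReal_mono (by finiteness) h2
  simpa using h3

theorem dBox_ball (hh : 0 < h) (c : ℕ × (Fin n → ℤ)) :
    dBox a h c = Metric.closedBall (dLo a h c + fun _ => h / 2 ^ c.1 / 2) (h / 2 ^ c.1 / 2) := by
  ext x
  have : 0 ≤ h / 2 ^ c.1 / 2 := by positivity
  rw [Metric.mem_closedBall, dist_pi_le_iff this, dBox, Set.mem_Icc, Pi.le_def, Pi.le_def,
    ← forall_and]
  refine forall_congr' fun j => ?_
  rw [Real.dist_eq, abs_le]
  simp only [Pi.add_apply]
  constructor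
  · rintro ⟨h1, h2⟩; constructor <;> linarith
  · rintro ⟨h1, h2⟩; constructor <;> linarith

theorem dAe (hh : 0 < h) (hb : LocallyIntegrable b volume) (hβt : β ≠ ⊤) :
    ∀ᵐ x ∂(volume : Measure (Fin n → ℝ)), ∀ S, x ∈ dCube a h S →
      x ∉ treeSet (dCube a h) (dCh a h b β) 1 S →
      ‖b x - avgC (dBox a h S) b‖ ≤ 2 * β.toReal := by
  rw [ae_all_iff]
  intro S
  have hli : LocallyIntegrable (fun x => ‖b x - avgC (dBox a h S) b‖) volume :=
    fun x => (hb.sub (locallyIntegrable_const _) x).norm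
  filter_upwards [IsUnifLocDoublingMeasure.ae_tendsto_average (volume : Measure (Fin n → ℝ))
    hli 1] with x hx hxS hxn
  have hnb : ∀ k, S.1 < k → ¬ dBad a h b β S (k, dIdx a h k x) := by
    by_contra hcon
    push Not at hcon
    classical
    have hsp := Nat.find_spec hcon
    have hmin := fun j (hj : j < Nat.find hcon) => Nat.find_min hcon hj
    set k := Nat.find hcon
    apply hxn
    rw [treeSet_one]
    refine Set.mem_iUnion₂.2 ⟨(k, dIdx a h k x), ⟨hsp.1, ?_, hsp.2, ?_⟩, dCube_self k x⟩
    · exact dCube_nest hsp.1.le hxS (dCube_self k x)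
    · intro P' h1 h2 h3 h4
      have h5 := dCube_eq_idx (h3 (dCube_self k x))
      rw [h5] at h4
      exact hmin P'.1 h2 ⟨h1, h4⟩
  have hlim := hx (l := Filter.atTop)
    (fun k : ℕ => dLo a h (k, dIdx a h k x) + fun _ => h / 2 ^ k / 2) (fun k : ℕ => h / 2 ^ k / 2)
    (by
      rw [tendsto_nhdsWithin_iff]
      refine ⟨?_, Filter.Eventually.of_forall fun k => by
        have : 0 < h / 2 ^ k / 2 := by positivity
        exact this⟩
      have := (tendsto_pow_atTop_nhds_zero_of_lt_one (r := (2⁻¹ : ℝ)) (by norm_num)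
        (by norm_num)).const_mul (h / 2)
      rw [mul_zero] at this
      refine this.congr fun k => ?_
      rw [inv_pow]; field_simp)
    (Filter.Eventually.of_forall fun k => by
      rw [one_mul]
      have := dBox_ball (a := a) hh (k, dIdx a h k x)
      simp only at this
      rw [← this]
      exact dCube_sub_dBox hh _ (dCube_self k x))
  refine le_of_tendsto hlim ?_
  filter_upwards [Filter.eventually_gt_atTop S.1] with k hk
  have hball := dBox_ball (a := a) hh (k, dIdx a h k x)
  simp only at hball
  rw [← hball]
  set P : ℕ × (Fin n → ℤ) := (k, dIdx a h k x)
  have h1 := not_lt.1 (hnb k hk)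
  change ∫⁻ x in dCube a h P, ‖b x - avgC (dBox a h S) b‖ₑ ≤ 2 * β * volume (dCube a h P) at h1
  have h0 := dCube_vol_ne_zero (a := a) hh P
  have ht := dCube_vol_ne_top (a := a) hh P
  rw [setLIntegral_congr (dCube_ae hh P), measure_congr (dCube_ae hh P)] at h1
  rw [measure_congr (dCube_ae hh P)] at h0 ht
  have hasm : AEStronglyMeasurable (fun x => b x - avgC (dBox a h S) b)
      (volume.restrict (dBox a h P)) :=
    (hb.aestronglyMeasurable.sub aestronglyMeasurable_const).restrict
  rw [setAverage_eq, smul_eq_mul, integral_norm_eq_lintegral_enorm hasm, measureReal_def,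
    inv_mul_le_iff₀ (ENNReal.toReal_pos h0 ht)]
  have h2 := ENNReal.toReal_mono (by finiteness) h1
  refine h2.trans (le_of_eq ?_)
  simp; ring

end Dyadic

section Key

variable {n : ℕ}

/-- The dimensional constant. -/
def epsN (n : ℕ) : ℝ := Real.log 2 / (9 * (2 * 2 ^ n))

theorem epsN_pos (n : ℕ) : 0 < epsN n := by
  have := Real.log_pos (one_lt_two)
  unfold epsN
  positivity

theorem fw_le (w : (Fin n → ℝ) → ℝ) (Q : Set (Fin n → ℝ)) (hQ : IsCube Q)
    (h0 : ∫⁻ x in Q, ENNReal.ofReal (w x) ≠ 0) (ht : ∫⁻ x in Q, ENNReal.ofReal (w x) ≠ ⊤) :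
    ∫⁻ x in Q, hlMax n (Q.indicator fun y => ENNReal.ofReal (w y)) x
      ≤ fwConst n w * ∫⁻ x in Q, ENNReal.ofReal (w x) :=
  (ENNReal.div_le_iff h0 ht).1 (le_iSup₂_of_le Q hQ le_rfl)

theorem cube_meas {Q : Set (Fin n → ℝ)} (hQ : IsCube Q) : MeasurableSet Q := by
  obtain ⟨a, h, _, rfl⟩ := hQ
  exact measurableSet_Icc

theorem cube_vol {Q : Set (Fin n → ℝ)} (hQ : IsCube Q) : volume Q ≠ 0 ∧ volume Q ≠ ⊤ := by
  obtain ⟨a, h, hh, rfl⟩ := hQ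
  rw [← dBox_root, ← measure_congr (dCube_ae hh _)]
  exact ⟨dCube_vol_ne_zero hh _, dCube_vol_ne_top hh _⟩

theorem fw_ge_one (w : (Fin n → ℝ) → ℝ) (Q : Set (Fin n → ℝ)) (hQ : IsCube Q)
    (h0 : ∫⁻ x in Q, ENNReal.ofReal (w x) ≠ 0) (ht : ∫⁻ x in Q, ENNReal.ofReal (w x) ≠ ⊤) :
    1 ≤ fwConst n w := by
  have h1 := fw_le w Q hQ h0 ht
  have h2 : ∫⁻ x in Q, ENNReal.ofReal (w x)
      ≤ ∫⁻ x in Q, hlMax n (Q.indicator fun y => ENNReal.ofReal (w y)) x := by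
    calc ∫⁻ x in Q, ENNReal.ofReal (w x)
        = ∫⁻ _ in Q, (∫⁻ x in Q, ENNReal.ofReal (w x)) / volume Q := by
          rw [setLIntegral_const, ENNReal.div_mul_cancel (cube_vol hQ).1 (cube_vol hQ).2]
      _ ≤ _ := by
          refine setLIntegral_mono' (cube_meas hQ) fun x hx => ?_
          refine le_iSup₂_of_le Q hQ (le_iSup_of_le hx (le_of_eq ?_))
          rw [avgL]
          congr 1
          exact setLIntegral_congr_fun (cube_meas hQ) fun y hy => by simp [hy]
  have h3 := h2.trans h1
  rw [← ENNReal.mul_le_mul_iff_left h0 ht, one_mul]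
  exact h3

theorem weight_pos (w : (Fin n → ℝ) → ℝ) (hwm : AEMeasurable w volume)
    (hpos : ∀ᵐ x ∂(volume : Measure (Fin n → ℝ)), 0 < w x) {D : Set (Fin n → ℝ)}
    (hD : volume D ≠ 0) : ∫⁻ x in D, ENNReal.ofReal (w x) ≠ 0 := by
  intro h0
  rw [lintegral_eq_zero_iff' hwm.ennreal_ofReal.restrict] at h0
  have : ∀ᵐ x ∂(volume.restrict D), False := by
    filter_upwards [h0, ae_restrict_of_ae hpos] with x h1 h2
    simp at h1
    linarith
  rw [Filter.eventually_false_iff_eq_bot, ae_eq_bot, Measure.restrict_eq_zero] at this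
  exact hD this

theorem key_exp (w : (Fin n → ℝ) → ℝ) (hwm : AEMeasurable w volume)
    (hpos : ∀ᵐ x ∂(volume : Measure (Fin n → ℝ)), 0 < w x)
    (b : (Fin n → ℝ) → ℂ) (hb : LocallyIntegrable b volume) (hbt : bmoNormC n b ≠ ⊤)
    (s : ℝ) (hs0 : 0 ≤ s)
    (hs : ENNReal.ofReal s ≤ ENNReal.ofReal (epsN n) / (fwConst n w * bmoNormC n b))
    (Q : Set (Fin n → ℝ)) (hQ : IsCube Q) :
    ∫⁻ x in Q, ENNReal.ofReal (Real.exp (s * ‖b x - avgC Q b‖)) * ENNReal.ofReal (w x)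
      ≤ 4 * ∫⁻ x in Q, ENNReal.ofReal (w x) := by
  have hQv := cube_vol hQ
  have htriv : (∀ᵐ x ∂(volume.restrict Q), s * ‖b x - avgC Q b‖ = 0) →
      ∫⁻ x in Q, ENNReal.ofReal (Real.exp (s * ‖b x - avgC Q b‖)) * ENNReal.ofReal (w x)
      ≤ 4 * ∫⁻ x in Q, ENNReal.ofReal (w x) := by
    intro h
    calc ∫⁻ x in Q, ENNReal.ofReal (Real.exp (s * ‖b x - avgC Q b‖)) * ENNReal.ofReal (w x)
        = 1 * ∫⁻ x in Q, ENNReal.ofReal (w x) := by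
          rw [one_mul]
          apply lintegral_congr_ae
          filter_upwards [h] with x hx
          simp [hx]
      _ ≤ _ := by gcongr; norm_num
  by_cases hβ0 : bmoNormC n b = 0
  · apply htriv
    have h1 : (∫⁻ x in Q, (‖b x - avgC Q b‖₊ : ℝ≥0∞)) / volume Q ≤ bmoNormC n b :=
      le_iSup₂_of_le Q hQ le_rfl
    rw [hβ0, ENNReal.div_le_iff hQv.1 hQv.2, zero_mul, nonpos_iff_eq_zero,
      lintegral_eq_zero_iff' (by
        exact (hb.aestronglyMeasurable.sub aestronglyMeasurable_const).enorm.restrict)] at h1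
    filter_upwards [h1] with x hx
    simp at hx
    simp [hx]
  by_cases hwt : ∫⁻ x in Q, ENNReal.ofReal (w x) = ⊤
  · rw [hwt]; simp
  have hw0 := weight_pos w hwm hpos hQv.1
  have hA1 := fw_ge_one w Q hQ hw0 hwt
  by_cases hAt : fwConst n w = ⊤
  · apply htriv
    rw [hAt, ENNReal.top_mul hβ0, ENNReal.div_top, nonpos_iff_eq_zero, ENNReal.ofReal_eq_zero] at hs
    have : s = 0 := le_antisymm hs hs0
    simp [this]
  have hA0 : fwConst n w ≠ 0 := fun h => by rw [h] at hA1; simp at hA1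
  have hsr : s * ((fwConst n w).toReal * (bmoNormC n b).toReal) ≤ epsN n := by
    rw [ENNReal.le_div_iff_mul_le (Or.inl (mul_ne_zero hA0 hβ0))
      (Or.inl (ENNReal.mul_ne_top hAt hbt))] at hs
    have := ENNReal.toReal_mono ENNReal.ofReal_ne_top hs
    simpa [ENNReal.toReal_mul, ENNReal.toReal_ofReal hs0, (epsN_pos n).le] using this
  have hA1r : 1 ≤ (fwConst n w).toReal := by
    have := ENNReal.toReal_mono hAt hA1
    simpa using this
  set A := fwConst n w with hAdef
  set β := bmoNormC n b with hβdef
  obtain ⟨a, h, hh, rfl⟩ := hQ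
  rw [← dBox_root] at hwt ⊢
  have T : GoodTree (dCube a h) (dCh a h b β) := dTree hh
  set m : ℕ := ⌈8 * A.toReal⌉₊ with hmdef
  have hm1 : 8 * A.toReal ≤ m := Nat.le_ceil _
  have hm2 : (m : ℝ) ≤ 9 * A.toReal := by
    have := (Nat.ceil_lt_add_one (a := 8 * A.toReal) (by positivity)).le
    linarith
  have hm3 : 8 * A ≤ (m : ℝ≥0∞) := by
    rw [← ENNReal.ofReal_toReal hAt, ← ENNReal.ofReal_natCast,
      show (8 : ℝ≥0∞) = ENNReal.ofReal 8 by simp, ← ENNReal.ofReal_mul (by norm_num)]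
    exact ENNReal.ofReal_le_ofReal hm1
  have hwt' : ∫⁻ x in dCube a h (0, 0), ENNReal.ofReal (w x) ≠ ⊤ := by
    rw [setLIntegral_congr (dCube_ae hh _)]; exact hwt
  have hq : ∀ c, dCube a h c ⊆ dCube a h (0, 0) →
      4 * ∫⁻ x in treeSet (dCube a h) (dCh a h b β) m c, ENNReal.ofReal (w x)
        ≤ ∫⁻ x in dCube a h c, ENNReal.ofReal (w x) := by
    intro S hS
    have hSt : ∫⁻ x in dCube a h S, ENNReal.ofReal (w x) ≠ ⊤ :=
      ((lintegral_mono_set hS).trans_lt hwt'.lt_top).ne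
    have hS0 := weight_pos w hwm hpos (dCube_vol_ne_zero (a := a) hh S)
    refine treeSet_quarter T _ (dHalf hh le_rfl hβ0 hbt) (dCube_vol_ne_zero hh)
      (dCube_vol_ne_top hh) (hlMax n ((dBox a h S).indicator fun y => ENNReal.ofReal (w y))) S
      ?_ A hA0 hAt ?_ m hm3
    · intro c hc x hx
      refine le_iSup₂_of_le (dBox a h c) (dBox_isCube hh c)
        (le_iSup_of_le (dCube_sub_dBox hh c hx) (le_of_eq ?_))
      rw [avgL, ← setLIntegral_congr (dCube_ae hh c), ← measure_congr (dCube_ae hh c)]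
      congr 1
      exact setLIntegral_congr_fun (dCube_meas hh c) fun y hy => by
        simp [dCube_sub_dBox hh S (hc hy)]
    · rw [setLIntegral_congr (dCube_ae hh S)] at hS0 hSt ⊢
      rw [setLIntegral_congr (dCube_ae hh S)]
      exact fw_le w _ (dBox_isCube hh S) hS0 hSt
  have hfinal := treeSet_exp T (fun x => ENNReal.ofReal (w x)) hwm.ennreal_ofReal (0, 0) hwt' m hq
    (fun c x => ‖b x - avgC (dBox a h c) b‖) (2 * 2 ^ n * β.toReal) (by positivity)
    (by
      intro S P hP x
      have h1 := dParent hh hb le_rfl hbt S P hP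
      have h2 := norm_sub_le_norm_sub_add_norm_sub (b x) (avgC (dBox a h P) b)
        (avgC (dBox a h S) b)
      linarith)
    (by
      filter_upwards [dAe (a := a) (β := β) hh hb hbt] with x hx S h1 h2
      refine (hx S h1 h2).trans ?_
      have : (1 : ℝ) ≤ 2 ^ n := one_le_pow₀ (by norm_num)
      have h3 : 0 ≤ β.toReal := ENNReal.toReal_nonneg
      nlinarith)
    s hs0
    (by
      rw [← Real.le_log_iff_exp_le (by norm_num)]
      calc s * (2 * 2 ^ n * β.toReal) * m ≤ s * (2 * 2 ^ n * β.toReal) * (9 * A.toReal) := by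
            gcongr
        _ = (s * (A.toReal * β.toReal)) * (9 * (2 * 2 ^ n)) := by ring
        _ ≤ epsN n * (9 * (2 * 2 ^ n)) := by gcongr
        _ = Real.log 2 := by rw [epsN]; field_simp)
  rw [setLIntegral_congr (dCube_ae hh _), setLIntegral_congr (dCube_ae hh _)] at hfinal
  exact hfinal

end Key

theorem apTerm_bound {n : ℕ} {p : ℝ} (hp : 1 < p) (w : (Fin n → ℝ) → ℝ) (hw : IsWeight n w)
    (b : (Fin n → ℝ) → ℂ) (hb : LocallyIntegrable b volume) (hbt : bmoNormC n b ≠ ⊤) (z : ℂ)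
    (hz : ENNReal.ofReal ‖z‖ ≤
      ENNReal.ofReal (epsN n * min 1 (p - 1)) / (apMax n p w * bmoNormC n b))
    (Q : Set (Fin n → ℝ)) (hQ : IsCube Q) :
    apTerm n p (fun x => Real.exp (b x * z).re * w x) Q ≤
      ENNReal.ofReal (4 ^ p) * apTerm n p w Q := by
  have hp1 : 0 < p - 1 := by linarith
  have hε := epsN_pos n
  have hwm : AEMeasurable w volume := hw.1.aestronglyMeasurable.aemeasurable
  have hpos := hw.2
  set q : ℝ := 1 - p / (p - 1) with hq
  have hqe : q = -(p - 1)⁻¹ := by rw [hq]; field_simp; ring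
  set t : ℝ := (avgC Q b * z).re with ht
  have hre : ∀ x, (b x * z).re = t + ((b x - avgC Q b) * z).re := by
    intro x; rw [ht, sub_mul, Complex.sub_re]; ring
  have habs : ∀ x, |((b x - avgC Q b) * z).re| ≤ ‖z‖ * ‖b x - avgC Q b‖ := by
    intro x
    refine (Complex.abs_re_le_norm _).trans ?_
    rw [norm_mul, mul_comm]
  have hs1 : ENNReal.ofReal ‖z‖ ≤ ENNReal.ofReal (epsN n) / (fwConst n w * bmoNormC n b) := by
    refine hz.trans ?_
    refine ENNReal.div_le_div (ENNReal.ofReal_le_ofReal ?_) ?_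
    · have := min_le_left 1 (p - 1)
      nlinarith
    · gcongr
      exact le_max_left _ _
  have hs2 : ENNReal.ofReal (‖z‖ / (p - 1)) ≤
      ENNReal.ofReal (epsN n) / (fwConst n (fun x => w x ^ q) * bmoNormC n b) := by
    rw [div_eq_inv_mul, ENNReal.ofReal_mul (by positivity)]
    calc ENNReal.ofReal (p - 1)⁻¹ * ENNReal.ofReal ‖z‖
        ≤ ENNReal.ofReal (p - 1)⁻¹ * (ENNReal.ofReal (epsN n * (p - 1)) /
          (fwConst n (fun x => w x ^ q) * bmoNormC n b)) := by
          gcongr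
          refine hz.trans ?_
          refine ENNReal.div_le_div (ENNReal.ofReal_le_ofReal ?_) ?_
          · have := min_le_right 1 (p - 1)
            nlinarith
          · gcongr
            exact le_max_right _ _
      _ = _ := by
          rw [← mul_div_assoc, ← ENNReal.ofReal_mul (by positivity)]
          congr 2
          field_simp
  have hk1 := key_exp w hwm hpos b hb hbt ‖z‖ (norm_nonneg z) hs1 Q hQ
  have hk2 := key_exp (fun x => w x ^ q) (hwm.pow_const q)
    (by filter_upwards [hpos] with x hx; exact Real.rpow_pos_of_pos hx q) b hb hbt
    (‖z‖ / (p - 1)) (by positivity) hs2 Q hQ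
  have h1 : avgL Q (fun x => ENNReal.ofReal (Real.exp (b x * z).re * w x))
      ≤ ENNReal.ofReal (Real.exp t) * (4 * avgL Q (fun x => ENNReal.ofReal (w x))) := by
    rw [avgL, avgL, ← mul_div_assoc, ← mul_div_assoc]
    gcongr
    refine le_trans ?_ (mul_le_mul_right hk1 _)
    rw [← lintegral_const_mul' _ _ ENNReal.ofReal_ne_top]
    refine lintegral_mono fun x => ?_
    rw [← mul_assoc, ← ENNReal.ofReal_mul (Real.exp_nonneg _), ← Real.exp_add,
      ENNReal.ofReal_mul (Real.exp_nonneg _)]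
    gcongr
    rw [hre]
    have := (abs_le.1 (habs x)).2
    linarith
  have h2 : avgL Q (fun x => ENNReal.ofReal (Real.exp (b x * z).re * w x) ^ q)
      ≤ ENNReal.ofReal (Real.exp (q * t)) * (4 * avgL Q (fun x => ENNReal.ofReal (w x) ^ q)) := by
    have he : ∫⁻ x in Q, ENNReal.ofReal (w x) ^ q = ∫⁻ x in Q, ENNReal.ofReal (w x ^ q) := by
      apply lintegral_congr_ae
      filter_upwards [ae_restrict_of_ae hpos] with x hx
      exact ENNReal.ofReal_rpow_of_pos hx
    rw [avgL, avgL, ← mul_div_assoc, ← mul_div_assoc, he]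
    gcongr
    refine le_trans ?_ (mul_le_mul_right hk2 _)
    rw [← lintegral_const_mul' _ _ ENNReal.ofReal_ne_top]
    refine lintegral_mono_ae ?_
    filter_upwards [ae_restrict_of_ae hpos] with x hx
    rw [ENNReal.ofReal_rpow_of_pos (by positivity),
      Real.mul_rpow (Real.exp_nonneg _) hx.le, ← Real.exp_mul,
      ← mul_assoc, ← ENNReal.ofReal_mul (Real.exp_nonneg _), ← Real.exp_add,
      ENNReal.ofReal_mul (Real.exp_nonneg _)]
    gcongr
    rw [hre, hqe]
    have h3 := (abs_le.1 (habs x)).1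
    have h4 : (p - 1)⁻¹ * (-(‖z‖ * ‖b x - avgC Q b‖)) ≤
      (p - 1)⁻¹ * ((b x - avgC Q b) * z).re := mul_le_mul_of_nonneg_left h3 (by positivity)
    rw [div_eq_inv_mul]
    linarith
  have h3 : avgL Q (fun x => ENNReal.ofReal (Real.exp (b x * z).re * w x) ^ q) ^ (p - 1)
      ≤ ENNReal.ofReal (Real.exp (-t)) * (ENNReal.ofReal (4 ^ (p - 1)) *
        avgL Q (fun x => ENNReal.ofReal (w x) ^ q) ^ (p - 1)) := by
    refine (ENNReal.rpow_le_rpow h2 hp1.le).trans (le_of_eq ?_)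
    rw [ENNReal.mul_rpow_of_nonneg _ _ hp1.le, ENNReal.mul_rpow_of_nonneg _ _ hp1.le,
      ENNReal.ofReal_rpow_of_pos (Real.exp_pos _), ← Real.exp_mul,
      show (4 : ℝ≥0∞) = ENNReal.ofReal 4 by simp, ENNReal.ofReal_rpow_of_pos (by norm_num)]
    congr 3
    rw [hqe]; field_simp
  rw [apTerm, apTerm]
  refine (mul_le_mul' h1 h3).trans (le_of_eq ?_)
  have h4 : ENNReal.ofReal (Real.exp t) * ENNReal.ofReal (Real.exp (-t)) = 1 := by
    rw [← ENNReal.ofReal_mul (Real.exp_nonneg _), ← Real.exp_add]; simp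
  have h5 : 4 * ENNReal.ofReal (4 ^ (p - 1)) = ENNReal.ofReal (4 ^ p) := by
    rw [show (4 : ℝ≥0∞) = ENNReal.ofReal 4 by simp, ← ENNReal.ofReal_mul (by norm_num)]
    congr 1
    rw [Real.rpow_sub_one (by norm_num)]; field_simp
  rw [← h5]
  calc _ = (ENNReal.ofReal (Real.exp t) * ENNReal.ofReal (Real.exp (-t))) *
      (4 * ENNReal.ofReal (4 ^ (p - 1)) * (avgL Q (fun x => ENNReal.ofReal (w x)) *
        avgL Q (fun x => ENNReal.ofReal (w x) ^ q) ^ (p - 1))) := by ring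
    _ = _ := by rw [h4, one_mul]

/-- There is `ε_n' > 0` depending only on `n` such that for `p ∈ (1,∞)`,
`w ∈ A_p`, `b ∈ BMO`, and `|z| ≤ ε_n' min(1, p-1)/((w)_{A_p} ‖b‖_{BMO})`, the `A_p` product of
`e^{Re(bz)} w` over every cube `Q` is at most `4^p [w]_{A_p}`; in particular
`[e^{Re(bz)} w]_{A_p} ≤ 4^p [w]_{A_p}`. -/
theorem exp_bmo_weight_Ap_quantitative (n : ℕ) :
    ∃ ε : ℝ, 0 < ε ∧
      ∀ p : ℝ, 1 < p →
      ∀ w : (Fin n → ℝ) → ℝ, IsWeight n w → apConst n p w ≠ ⊤ →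
      ∀ b : (Fin n → ℝ) → ℂ, MeasureTheory.LocallyIntegrable b volume →
        bmoNormC n b ≠ ⊤ →
      ∀ z : ℂ,
        ENNReal.ofReal ‖z‖ ≤
          ENNReal.ofReal (ε * min 1 (p - 1)) / (apMax n p w * bmoNormC n b) →
        (∀ Q : Set (Fin n → ℝ), IsCube Q →
          apTerm n p (fun x => Real.exp (b x * z).re * w x) Q ≤
            ENNReal.ofReal (4 ^ p) * apConst n p w) ∧
        apConst n p (fun x => Real.exp (b x * z).re * w x) ≤
          ENNReal.ofReal (4 ^ p) * apConst n p w := by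
  refine ⟨epsN n, epsN_pos n, ?_⟩
  intro p hp w hw _ b hb hbt z hz
  have hmain : ∀ Q : Set (Fin n → ℝ), IsCube Q →
      apTerm n p (fun x => Real.exp (b x * z).re * w x) Q ≤
        ENNReal.ofReal (4 ^ p) * apConst n p w := by
    intro Q hQ
    refine (apTerm_bound hp w hw b hb hbt z hz Q hQ).trans ?_
    gcongr
    exact le_iSup₂_of_le Q hQ le_rfl
  exact ⟨hmain, iSup₂_le hmain⟩

end
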